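/- Let O be a finite set of items, let v_1, v_2 be nonnegative additive valuations on O with v_1(O) = v_2(O) = 1, and define chore costs c_1 = v_1, c_2 = v_2. Let OPT⁺ denote the maximum social welfare over all goods-EF1 allocations of O and OPT⁻ the minimum social cost over all chores-EF1 allocations of O. For every ε > 0: if (B_1, B_2) is a goods-EF1 allocation with SW(B_1, B_2) ≥ (1 − ε/2)·OPT⁺, then the swapped allocation (B_2, B_1) is chores-EF1 and satisfies SC(B_2, B_1) ≤ OPT⁻ + ε. -/

import Mathlib

open Finset

/-- Goods EF1 for two agents. -/
def GoodsEF1 {ι : Type*} [DecidableEq ι] (v : Fin 2 → ι → ℝ)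
    (A : Fin 2 → Finset ι) : Prop :=
  ∀ i j : Fin 2, ∃ S ⊆ A j, S.card ≤ 1 ∧ ∑ o ∈ A j \ S, v i o ≤ ∑ o ∈ A i, v i o

/-- Chores EF1 for two agents. -/
def ChoresEF1 {ι : Type*} [DecidableEq ι] (c : Fin 2 → ι → ℝ)
    (A : Fin 2 → Finset ι) : Prop :=
  ∀ i j : Fin 2, ∃ S ⊆ A i, S.card ≤ 1 ∧ ∑ o ∈ A i \ S, c i o ≤ ∑ o ∈ A j, c i o

/-- Social welfare of a two-agent allocation. -/
def SW {ι : Type*} (v : Fin 2 → ι → ℝ) (A : Fin 2 → Finset ι) : ℝ :=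
  ∑ i, ∑ o ∈ A i, v i o

/-- Social cost of a two-agent allocation. -/
def SC {ι : Type*} (c : Fin 2 → ι → ℝ) (A : Fin 2 → Finset ι) : ℝ :=
  ∑ i, ∑ o ∈ A i, c i o

theorem choresEF1_swap_iff {ι : Type*} [DecidableEq ι] (v : Fin 2 → ι → ℝ)
    (A : Fin 2 → Finset ι) : ChoresEF1 v ![A 1, A 0] ↔ GoodsEF1 v A := by
  have self (i : Fin 2) (s : Finset ι) :
      ∃ S ⊆ s, S.card ≤ 1 ∧ ∑ o ∈ s \ S, v i o ≤ ∑ o ∈ s, v i o :=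
    ⟨∅, by simp⟩
  simp [ChoresEF1, GoodsEF1, Fin.forall_fin_two, self]

theorem goodsEF1_swap_iff {ι : Type*} [DecidableEq ι] (v : Fin 2 → ι → ℝ)
    (A : Fin 2 → Finset ι) : GoodsEF1 v ![A 1, A 0] ↔ ChoresEF1 v A := by
  have h : ![A 0, A 1] = A := by ext i; fin_cases i <;> rfl
  simpa [h] using (choresEF1_swap_iff v ![A 1, A 0]).symm

/-- The values of an allocation and of its swap add up to the total value of all the items. -/
theorem SW_add_SC_swap {ι : Type*} [Fintype ι] [DecidableEq ι] (v : Fin 2 → ι → ℝ)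
    (hnorm : ∀ i, ∑ o, v i o = 1) (A : Fin 2 → Finset ι) (hdisj : Disjoint (A 0) (A 1))
    (hcover : A 0 ∪ A 1 = Finset.univ) : SW v A + SC v ![A 1, A 0] = 2 := by
  have h (i : Fin 2) : ∑ o ∈ A 0, v i o + ∑ o ∈ A 1, v i o = 1 := by
    rw [← sum_union hdisj, hcover, hnorm]
  simp only [SW, SC, Fin.sum_univ_two, Matrix.cons_val_zero, Matrix.cons_val_one]
  linarith [h 0, h 1]

/-- Transferring a `(1 - ε/2)`-approximate goods-EF1 welfare maximizer to chores: the swapped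
allocation is chores-EF1 with social cost at most `OPT⁻ + ε`. -/
theorem approx_transfer_goods_to_chores (ι : Type*) [Fintype ι] [DecidableEq ι]
    (v : Fin 2 → ι → ℝ) (hnn : ∀ i o, 0 ≤ v i o) (hnorm : ∀ i, ∑ o, v i o = 1)
    (OPTp OPTm : ℝ)
    (hOPTp : IsGreatest {w : ℝ | ∃ A : Fin 2 → Finset ι, Disjoint (A 0) (A 1) ∧
      A 0 ∪ A 1 = Finset.univ ∧ GoodsEF1 v A ∧ SW v A = w} OPTp)
    (hOPTm : IsLeast {w : ℝ | ∃ A : Fin 2 → Finset ι, Disjoint (A 0) (A 1) ∧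
      A 0 ∪ A 1 = Finset.univ ∧ ChoresEF1 v A ∧ SC v A = w} OPTm)
    (ε : ℝ) (hε : 0 < ε)
    (B : Fin 2 → Finset ι) (hdisj : Disjoint (B 0) (B 1))
    (hcover : B 0 ∪ B 1 = Finset.univ) (hB : GoodsEF1 v B)
    (hSW : (1 - ε / 2) * OPTp ≤ SW v B) :
    ChoresEF1 v ![B 1, B 0] ∧ SC v ![B 1, B 0] ≤ OPTm + ε := by
  refine ⟨(choresEF1_swap_iff v B).2 hB, ?_⟩
  obtain ⟨⟨G, -, -, -, rfl⟩, hmax⟩ := hOPTp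
  obtain ⟨⟨C, hCd, hCc, hC, rfl⟩, -⟩ := hOPTm
  have hC' : SW v ![C 1, C 0] ≤ SW v G :=
    hmax ⟨![C 1, C 0], hCd.symm, (union_comm _ _).trans hCc, (goodsEF1_swap_iff v C).2 hC, rfl⟩
  have hG : SW v G ≤ 2 := by
    have h (i : Fin 2) : ∑ o ∈ G i, v i o ≤ 1 :=
      (sum_le_univ_sum_of_nonneg (hnn i)).trans_eq (hnorm i)
    rw [SW, Fin.sum_univ_two]
    linarith [h 0, h 1]
  have hBsum := SW_add_SC_swap v hnorm B hdisj hcover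
  have hCsum : SC v C + SW v ![C 1, C 0] = 2 := SW_add_SC_swap v hnorm C hCd hCc
  nlinarith
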